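/- Let λ be a cardinal (finite or infinite) and let G be a graph such that there exists a well-ordering of the vertex set of G in which every vertex v has at most λ many edges joining it to vertices preceding v, and such that G admits a λ-packing. Then G admits a λ-decomposition. -/

import Mathlib

universe u
open Cardinal

/-- `T` is a spanning tree of `G`: a connected, acyclic subgraph of `G`
containing all vertices of `G` (as `T` lives on the same vertex type `V`,
connectedness of `T` already makes it spanning). -/
def IsSpanningTree {V : Type u} (G T : SimpleGraph V) : Prop :=
  T ≤ G ∧ T.IsTree

/-- A λ-packing of `G`: a family of λ many pairwise edge-disjoint spanning trees. -/
def HasPacking {V : Type u} (G : SimpleGraph V) (lam : Cardinal.{u}) : Prop :=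
  ∃ (ι : Type u) (T : ι → SimpleGraph V), #ι = lam ∧
    (∀ i, IsSpanningTree G (T i)) ∧
    Pairwise (fun i j => Disjoint (T i).edgeSet (T j).edgeSet)

/-- A λ-decomposition of `G`: a family of λ many spanning trees whose edge sets
partition the edge set of `G`. -/
def HasDecomposition {V : Type u} (G : SimpleGraph V) (lam : Cardinal.{u}) : Prop :=
  ∃ (ι : Type u) (T : ι → SimpleGraph V), #ι = lam ∧
    (∀ i, IsSpanningTree G (T i)) ∧
    (Pairwise (fun i j => Disjoint (T i).edgeSet (T j).edgeSet)) ∧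
    (⋃ i, (T i).edgeSet) = G.edgeSet

section VecBase

open Submodule

variable {K E Y : Type*} [Field K] [AddCommGroup Y] [Module K Y] {φ : E → Y}

/-- `B` is a basis of the family `φ`: it is linearly independent and spans every `φ e`. -/
def IsVecBase (K : Type*) {E Y : Type*} [Field K] [AddCommGroup Y] [Module K Y]
    (φ : E → Y) (B : Set E) : Prop :=
  LinearIndepOn K φ B ∧ ∀ e, φ e ∈ span K (φ '' B)

lemma exists_mem_notMem_span_diff_singleton {S D C : Set E} {e : E} (hS : LinearIndepOn K φ S)
    (hD : φ e ∈ span K (φ '' (S ∩ D))) (hC : φ e ∉ span K (φ '' (S ∩ C))) :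
    ∃ f ∈ S, f ∈ D ∧ f ∉ C ∧ φ e ∉ span K (φ '' (S \ {f})) := by
  by_contra! hcon
  obtain ⟨l, hl, hle⟩ := (Finsupp.mem_span_image_iff_linearCombination K).1 hD
  refine hC ((Finsupp.mem_span_image_iff_linearCombination K).2 ⟨l, fun f hf => ?_, hle⟩)
  have hfSD := hl hf
  refine ⟨hfSD.1, ?_⟩
  by_contra hfC
  obtain ⟨l', hl', hle'⟩ := (Finsupp.mem_span_image_iff_linearCombination K).1
    (hcon f hfSD.1 hfSD.2 hfC)
  have hsub : l - l' = 0 := by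
    refine linearIndepOn_iff.1 hS _ (sub_mem ?_ ?_) (by rw [map_sub, hle, hle', sub_self])
    · exact Finsupp.supported_mono Set.inter_subset_left hl
    · exact Finsupp.supported_mono Set.sdiff_subset hl'
  have h0 : l' f = 0 := by
    by_contra h0
    exact (hl' (Finsupp.mem_support_iff.2 h0)).2 rfl
  rw [sub_eq_zero.1 hsub] at hf
  exact Finsupp.mem_support_iff.1 hf h0

lemma span_image_le_of_swap {S : Set E} {e f : E} (he : φ e ∈ span K (φ '' S)) (hf : f ∈ S)
    (hef : φ e ∉ span K (φ '' (S \ {f}))) :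
    span K (φ '' S) ≤ span K (φ '' insert e (S \ {f})) := by
  rw [span_le]
  rintro _ ⟨x, hx, rfl⟩
  by_cases hxf : x = f
  · subst hxf
    rw [Set.image_insert_eq]
    refine mem_span_insert_exchange ?_ hef
    rwa [← Set.image_insert_eq, Set.insert_sdiff_singleton, Set.insert_eq_of_mem hf]
  · exact subset_span ⟨x, Or.inr ⟨hx, hxf⟩, rfl⟩

lemma IsVecBase.swap {S : Set E} {e f : E} (hS : IsVecBase K φ S) (hf : f ∈ S)
    (hef : φ e ∉ span K (φ '' (S \ {f}))) : IsVecBase K φ (insert e (S \ {f})) :=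
  ⟨(hS.1.mono Set.sdiff_subset).insert hef,
    fun x => span_image_le_of_swap (hS.2 e) hf hef (hS.2 x)⟩

/-- Independence of a block triangular family: `π a` kills the blocks below `a`, and the
block `a` is independent after applying `π a`. -/
lemma linearIndepOn_of_triangular {α Z : Type*} [LinearOrder α] [AddCommGroup Z] [Module K Z]
    {S : Set E} (ρ : E → α) (π : α → Y →ₗ[K] Z)
    (hlow : ∀ a, ∀ e ∈ S, ρ e < a → π a (φ e) = 0)
    (hblock : ∀ a, LinearIndepOn K (fun e => π a (φ e)) {e | e ∈ S ∧ ρ e = a}) :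
    LinearIndepOn K φ S := by
  classical
  rw [linearIndepOn_iff']
  intro t g hts h0
  by_contra! hne
  obtain ⟨i, hi, hi0⟩ := hne
  obtain ⟨j, hj, hjmax⟩ := (t.filter fun i => g i ≠ 0).exists_max_image ρ
    ⟨i, Finset.mem_filter.2 ⟨hi, hi0⟩⟩
  rw [Finset.mem_filter] at hj
  refine hj.2 (linearIndepOn_iff'.1 (hblock (ρ j)) (t.filter fun i => ρ i = ρ j) g ?_ ?_ j
    (Finset.mem_filter.2 ⟨hj.1, rfl⟩))
  · intro x hx
    have hx' := Finset.mem_filter.1 hx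
    exact ⟨hts hx'.1, hx'.2⟩
  · have h1 := congrArg (π (ρ j)) h0
    simp only [map_sum, map_smul, map_zero] at h1
    rw [← h1, Finset.sum_filter_of_ne]
    intro x hx hne
    by_contra hxj
    rcases lt_or_gt_of_ne hxj with hlt | hgt
    · exact hne (by rw [hlow _ x (hts hx) hlt, smul_zero])
    · by_cases hgx : g x = 0
      · exact hne (by rw [hgx, zero_smul])
      · exact absurd (hjmax x (Finset.mem_filter.2 ⟨hx, hgx⟩)) (not_le.2 hgt)

/-- Infinitely many disjoint bases of a family that is not larger than the number of bases
can be rearranged into a partition into bases. -/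
theorem exists_partition_isVecBase_of_infinite {ι E : Type u} {Y : Type*} [AddCommGroup Y]
    [Module K Y] [Infinite ι] {φ : E → Y} (hE : #E ≤ #ι) (hφ : ∀ e, φ e ≠ 0) (B : ι → Set E)
    (hB : ∀ i, IsVecBase K φ (B i)) (hdisj : Pairwise (Function.onFun Disjoint B)) :
    ∃ B' : ι → Set E, (∀ i, IsVecBase K φ (B' i)) ∧ Pairwise (Function.onFun Disjoint B') ∧
      ∀ e, ∃ i, e ∈ B' i := by
  classical
  have huniq : ∀ {x i j}, x ∈ B i → x ∈ B j → i = j := fun {x i j} hi hj => by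
    by_contra hij
    exact Set.disjoint_left.1 (hdisj hij) hi hj
  obtain ⟨j, hj, hjB⟩ : ∃ j : E → ι, Function.Injective j ∧ ∀ e, e ∉ B (j e) := by
    have hcard : #(E × Bool) ≤ #ι := by
      have : #(E × Bool) = #E * 2 := by simp
      rw [this]
      calc #E * 2 ≤ #ι * #ι := mul_le_mul' hE ((natCast_lt_aleph0 (n := 2)).le.trans (aleph0_le_mk ι))
        _ = #ι := mul_eq_self (aleph0_le_mk ι)
    obtain ⟨k⟩ := hcard
    refine ⟨fun e => if e ∈ B (k (e, true)) then k (e, false) else k (e, true), ?_, ?_⟩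
    · intro a b hab
      dsimp only at hab
      split_ifs at hab <;> simpa using k.injective hab
    · intro e
      dsimp only
      split_ifs with h
      · intro h'
        simpa using k.injective (huniq h h')
      · exact h
  have hf : ∀ e, ∃ f ∈ B (j e), φ e ∉ span K (φ '' (B (j e) \ {f})) := fun e => by
    obtain ⟨f, hf, -, -, h⟩ := exists_mem_notMem_span_diff_singleton (D := Set.univ) (C := ∅)
      (hB (j e)).1 (by simpa using (hB (j e)).2 e) (by simpa using hφ e)
    exact ⟨f, hf, h⟩
  choose f hfB hf using hf
  -- the edges that have to be swapped in: those uncovered at first or swapped out later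
  let U : Set E := ⋂₀ {U | (∀ e, (∀ i, e ∉ B i) → e ∈ U) ∧ ∀ e ∈ U, f e ∈ U}
  have hU0 : ∀ e, (∀ i, e ∉ B i) → e ∈ U := fun e he U' hU' => hU'.1 e he
  have hU1 : ∀ e ∈ U, f e ∈ U := fun e he U' hU' => hU'.2 e (he U' hU')
  have hU2 : ∀ x ∈ U, (∀ i, x ∉ B i) ∨ ∃ e ∈ U, f e = x := by
    intro x hx
    refine (hx {x | x ∈ U ∧ ((∀ i, x ∉ B i) ∨ ∃ e ∈ U, f e = x)} ⟨?_, ?_⟩).2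
    · exact fun e he => ⟨hU0 e he, Or.inl he⟩
    · exact fun e he => ⟨hU1 e he.1, Or.inr ⟨e, he.1, rfl⟩⟩
  let B' : ι → Set E := fun i => {x | (x ∈ U ∧ j x = i) ∨ (x ∈ B i ∧ ∀ e ∈ U, j e = i → x ≠ f e)}
  have hB'U : ∀ e ∈ U, B' (j e) = insert e (B (j e) \ {f e}) := by
    intro e he
    ext x
    simp only [B', Set.mem_ofPred_eq, Set.mem_insert_iff, Set.mem_sdiff, Set.mem_singleton_iff]
    constructor
    · rintro (⟨-, h⟩ | ⟨h1, h2⟩)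
      · exact Or.inl (hj h)
      · exact Or.inr ⟨h1, h2 e he rfl⟩
    · rintro (rfl | ⟨h1, h2⟩)
      · exact Or.inl ⟨he, rfl⟩
      · refine Or.inr ⟨h1, fun e' _ h => ?_⟩
        rwa [hj h]
  refine ⟨B', fun i => ?_, ?_, ?_⟩
  · by_cases hi : ∃ e ∈ U, j e = i
    · obtain ⟨e, he, rfl⟩ := hi
      rw [hB'U e he]
      exact (hB _).swap (hfB e) (hf e)
    · have : B' i = B i := by
        ext x
        simp only [B', Set.mem_ofPred_eq]
        constructor
        · rintro (h | h)
          · exact absurd ⟨x, h⟩ hi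
          · exact h.1
        · exact fun h => Or.inr ⟨h, fun e he hje => absurd ⟨e, he, hje⟩ hi⟩
      rw [this]
      exact hB i
  · have key : ∀ x i, x ∈ U → x ∈ B i → ¬ ∀ e ∈ U, j e = i → x ≠ f e := by
      intro x i hx hxi h
      rcases hU2 x hx with h0 | ⟨e, he, rfl⟩
      · exact h0 i hxi
      · exact h e he (huniq (hfB e) hxi) rfl
    intro a b hab
    refine Set.disjoint_left.2 ?_
    rintro x (⟨h1, h2⟩ | ⟨h1, h2⟩) (⟨h3, h4⟩ | ⟨h3, h4⟩)
    · exact hab (h2.symm.trans h4)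
    · exact key x b h1 h3 h4
    · exact key x a h3 h1 h2
    · exact hab (huniq h1 h3)
  · intro e
    by_cases he : e ∈ U
    · exact ⟨j e, Or.inl ⟨he, rfl⟩⟩
    · have : ∃ i, e ∈ B i := by
        by_contra! h
        exact he (hU0 e h)
      obtain ⟨i, hi⟩ := this
      exact ⟨i, Or.inr ⟨hi, fun e' he' _ h => he (h ▸ hU1 e' he')⟩⟩


/-- If each `φ e` lies outside the span of the lower levels, then an independent set below
level `n` remains independent after adding at most one element of every level from `n` on. -/
lemma LinearIndepOn.union_transversal {h : E → ℕ}
    (htri : ∀ e, φ e ∉ span K (φ '' {e' | h e' < h e})) {n : ℕ} {F A : Set E}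
    (hF : LinearIndepOn K φ F) (hFn : ∀ e ∈ F, h e < n) (hA : ∀ e ∈ A, n ≤ h e)
    (hinj : Set.InjOn h A) : LinearIndepOn K φ (F ∪ A) := by
  have hchain : ∀ k, LinearIndepOn K φ (F ∪ {e | e ∈ A ∧ h e < k}) := by
    intro k
    induction k with
    | zero => simpa using hF
    | succ k ih =>
      by_cases hk : ∃ e ∈ A, h e = k
      · obtain ⟨e, heA, rfl⟩ := hk
        refine (ih.insert (x := e) fun hmem => htri e (span_mono (Set.image_mono ?_) hmem)).mono ?_
        · rintro x (hx | hx)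
          · exact (hFn x hx).trans_le (hA e heA)
          · exact hx.2
        · rintro x (hx | ⟨hx, hlt⟩)
          · exact Or.inr (Or.inl hx)
          · rcases Nat.lt_succ_iff_lt_or_eq.1 hlt with h' | h'
            · exact Or.inr (Or.inr ⟨hx, h'⟩)
            · exact Or.inl (hinj hx heA h')
      · refine ih.mono ?_
        rintro x (hx | ⟨hx, hlt⟩)
        · exact Or.inl hx
        · rcases Nat.lt_succ_iff_lt_or_eq.1 hlt with h' | h'
          · exact Or.inr ⟨hx, h'⟩
          · exact absurd ⟨x, hx, h'⟩ hk
  refine (linearIndepOn_iUnion_of_directed (s := fun k => F ∪ {e | e ∈ A ∧ h e < k})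
    (Monotone.directed_le ?_) hchain).mono ?_
  · intro a b hab x hx
    exact hx.imp_right fun hx => ⟨hx.1, hx.2.trans_le hab⟩
  · rintro x (hx | hx)
    · exact Set.mem_iUnion.2 ⟨0, Or.inl hx⟩
    · exact Set.mem_iUnion.2 ⟨h x + 1, Or.inr ⟨hx, Nat.lt_succ_self _⟩⟩

lemma finite_setOf_level_lt {ι : Type*} [Finite ι] {h : E → ℕ} {c : E → ι}
    (hc : ∀ e e', h e = h e' → c e = c e' → e = e') (n : ℕ) : {e | h e < n}.Finite := by
  refine Set.Finite.of_finite_image (f := fun e => (h e, c e)) ?_ ?_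
  · refine Set.Finite.subset ((Set.finite_Iio n).prod Set.finite_univ) ?_
    rintro _ ⟨e, he, rfl⟩
    exact ⟨he, trivial⟩
  · intro a _ b _ hab
    exact hc a b (congrArg Prod.fst hab) (congrArg Prod.snd hab)

/-- Disjoint bases covering all levels below `n` can be modified to cover all levels below `m`,
keeping the levels below `n` fixed and not shrinking the spans of the parts below `m`. -/
lemma exists_isVecBase_cover_extension {ι : Type*} [Finite ι] {h : E → ℕ} {c : E → ι}
    (hc : ∀ e e', h e = h e' → c e = c e' → e = e')
    (htri : ∀ e, φ e ∉ span K (φ '' {e' | h e' < h e})) {n m : ℕ} (hnm : n ≤ m)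
    {S : ι → Set E} (hS : ∀ i, IsVecBase K φ (S i))
    (hdisj : Pairwise (Function.onFun Disjoint S)) (hcov : ∀ e, h e < n → ∃ i, e ∈ S i) :
    ∃ S' : ι → Set E, (∀ i, IsVecBase K φ (S' i)) ∧ Pairwise (Function.onFun Disjoint S') ∧
      (∀ e, h e < n → ∀ i, e ∈ S' i ↔ e ∈ S i) ∧
      (∀ i, span K (φ '' (S i ∩ {e | h e < m})) ≤ span K (φ '' (S' i ∩ {e | h e < m}))) ∧
      ∀ e, h e < m → ∃ i, e ∈ S' i := by
  classical
  have hfin := finite_setOf_level_lt hc m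
  -- the colouring of `E` into independent sets towards which the bases are moved
  obtain ⟨col, hcol1, hcol2⟩ : ∃ col : E → ι, (∀ e, h e < n → e ∈ S (col e)) ∧
      ∀ e, n ≤ h e → col e = c e := by
    refine ⟨fun e => if he : h e < n then (hcov e he).choose else c e, fun e he => ?_,
      fun e he => ?_⟩
    · simp only [he, dif_pos]
      exact (hcov e he).choose_spec
    · simp only [not_lt.2 he, dif_neg, not_false_eq_true]
  have hcolI : ∀ i, LinearIndepOn K φ {e | col e = i} := by
    intro i
    refine (LinearIndepOn.union_transversal htri (n := n) (F := {e | col e = i ∧ h e < n})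
      (A := {e | col e = i ∧ n ≤ h e}) ((hS i).1.mono ?_) (fun e he => he.2) (fun e he => he.2)
      ?_).mono ?_
    · rintro e ⟨rfl, he⟩
      exact hcol1 e he
    · rintro a ⟨ha, han⟩ b ⟨hb, hbn⟩ hab
      refine hc a b hab ?_
      rw [← hcol2 a han, ← hcol2 b hbn, ha, hb]
    · intro e he
      exact (lt_or_ge (h e) n).imp (fun h' => ⟨he, h'⟩) fun h' => ⟨he, h'⟩
  let Valid : (ι → Set E) → Prop := fun S' => (∀ i, IsVecBase K φ (S' i)) ∧
    Pairwise (Function.onFun Disjoint S') ∧ (∀ e, h e < n → ∀ i, e ∈ S' i ↔ e ∈ S i) ∧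
    ∀ i, span K (φ '' (S i ∩ {e | h e < m})) ≤ span K (φ '' (S' i ∩ {e | h e < m}))
  let good : (ι → Set E) → Set E := fun S' => {e | h e < m ∧ e ∈ S' (col e)}
  let pot : (ι → Set E) → ℕ := fun S' => ({e | h e < m} \ good S').ncard
  obtain ⟨S', hS', hmin⟩ := (measure pot).wf.has_min {S' | Valid S'}
    ⟨S, hS, hdisj, fun _ _ _ => Iff.rfl, fun _ => le_rfl⟩
  refine ⟨S', hS'.1, hS'.2.1, hS'.2.2.1, hS'.2.2.2, ?_⟩
  by_contra! hunc
  obtain ⟨e, hem, heS⟩ := hunc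
  have hen : n ≤ h e := by
    by_contra! hlt
    obtain ⟨i, hi⟩ := hcov e hlt
    exact heS i ((hS'.2.2.1 e hlt i).2 hi)
  -- it suffices to find an element to be exchanged for `e`
  obtain ⟨f, hfS, hf, hfspan, hfgood⟩ : ∃ f ∈ S' (col e), φ e ∉ span K (φ '' (S' (col e) \ {f})) ∧
      (h f < m → φ e ∈ span K (φ '' (S' (col e) ∩ {e | h e < m}))) ∧
      (h f < m → col f ≠ col e) := by
    by_cases hspan : φ e ∈ span K (φ '' (S' (col e) ∩ {e | h e < m}))
    · have hsub : S' (col e) ∩ {x | col x = col e} ⊆ {x | col x = col e} \ {e} := by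
        rintro x ⟨hx, hxc⟩
        refine ⟨hxc, ?_⟩
        rintro rfl
        exact heS _ hx
      obtain ⟨f, hfS, hfm, hfC, hf⟩ := exists_mem_notMem_span_diff_singleton
        (C := {x | col x = col e}) (hS'.1 (col e)).1 hspan fun hmem =>
          (hcolI (col e)).notMem_span (i := e) rfl (span_mono (Set.image_mono hsub) hmem)
      exact ⟨f, hfS, hf, fun _ => hspan, fun _ => hfC⟩
    · obtain ⟨f, hfS, -, hfC, hf⟩ := exists_mem_notMem_span_diff_singleton
        (D := Set.univ) (hS'.1 (col e)).1 (by simpa using (hS'.1 (col e)).2 e) hspan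
      exact ⟨f, hfS, hf, fun h' => absurd h' hfC, fun h' => absurd h' hfC⟩
  have hfn : n ≤ h f := by
    by_contra! hlt
    refine hfgood (hlt.trans_le hnm) ?_
    by_contra hne
    exact Set.disjoint_left.1 (hdisj hne) (hcol1 f hlt) ((hS'.2.2.1 f hlt _).1 hfS)
  let S'' : ι → Set E := Function.update S' (col e) (insert e (S' (col e) \ {f}))
  have hS''e : S'' (col e) = insert e (S' (col e) \ {f}) := Function.update_self _ _ _
  have hS''ne : ∀ i, i ≠ col e → S'' i = S' i := fun i hi => Function.update_of_ne hi _ _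
  have hsub : ∀ i, S'' i ⊆ insert e (S' i) := by
    intro i
    by_cases hi : i = col e
    · rw [hi, hS''e]
      exact Set.insert_subset_insert Set.sdiff_subset
    · rw [hS''ne i hi]
      exact Set.subset_insert _ _
  have heS'' : ∀ i, e ∈ S'' i → i = col e := by
    intro i hi
    by_contra hne
    rw [hS''ne i hne] at hi
    exact heS i hi
  refine hmin S'' ⟨fun i => ?_, ?_, fun x hx i => ?_, fun i => (hS'.2.2.2 i).trans ?_⟩ ?_
  · by_cases hi : i = col e
    · rw [hi, hS''e]
      exact (hS'.1 _).swap hfS hf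
    · rw [hS''ne i hi]
      exact hS'.1 i
  · intro a b hab
    refine Set.disjoint_left.2 fun x hxa hxb => ?_
    rcases hsub a hxa with rfl | ha
    · exact hab ((heS'' a hxa).trans (heS'' b hxb).symm)
    · rcases hsub b hxb with rfl | hb
      · exact hab ((heS'' a hxa).trans (heS'' b hxb).symm)
      · exact Set.disjoint_left.1 (hS'.2.1 hab) ha hb
  · rw [← hS'.2.2.1 x hx i]
    by_cases hi : i = col e
    · have hxe : x ≠ e := by
        rintro rfl
        omega
      have hxf : x ≠ f := by
        rintro rfl
        omega
      rw [hi, hS''e]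
      simp [hxe, hxf]
    · rw [hS''ne i hi]
  · by_cases hi : i = col e
    · rw [hi, hS''e]
      by_cases hfm : h f < m
      · refine (span_image_le_of_swap (f := f) (hfspan hfm) ⟨hfS, hfm⟩ fun hmem => hf
          (span_mono (Set.image_mono ?_) hmem)).trans (span_mono (Set.image_mono ?_))
        · rintro x ⟨⟨hx, -⟩, hxf⟩
          exact ⟨hx, hxf⟩
        · rintro x (rfl | ⟨⟨hx, hxm⟩, hxf⟩)
          · exact ⟨Or.inl rfl, hem⟩
          · exact ⟨Or.inr ⟨hx, hxf⟩, hxm⟩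
      · refine span_mono (Set.image_mono ?_)
        rintro x ⟨hx, hxm⟩
        refine ⟨Or.inr ⟨hx, ?_⟩, hxm⟩
        rintro rfl
        exact hfm hxm
    · rw [hS''ne i hi]
  · refine Set.ncard_lt_ncard (Set.ssubset_iff_of_subset ?_ |>.2 ⟨e, ⟨hem, ?_⟩, ?_⟩)
      (hfin.subset Set.sdiff_subset)
    · rintro x ⟨hxm, hx⟩
      refine ⟨hxm, fun hxg => hx ⟨hxm, ?_⟩⟩
      by_cases hxe : col x = col e
      · have hxf : x ≠ f := by
          rintro rfl
          exact hfgood hxm hxe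
        have := hxg.2
        rw [hxe] at this ⊢
        rw [hS''e]
        exact Or.inr ⟨this, hxf⟩
      · rw [hS''ne _ hxe]
        exact hxg.2
    · exact fun hg => heS _ hg.2
    · refine fun hg => hg.2 ⟨hem, ?_⟩
      rw [hS''e]
      exact Or.inl rfl

/-- Finitely many disjoint bases can be rearranged into a partition into bases, if the family
is stratified into levels of size at most the number of bases, each vector lying outside the
span of the lower levels. -/
theorem exists_partition_isVecBase_of_finite {ι : Type*} [Finite ι] {h : E → ℕ} {c : E → ι}
    (hc : ∀ e e', h e = h e' → c e = c e' → e = e')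
    (htri : ∀ e, φ e ∉ span K (φ '' {e' | h e' < h e})) (B : ι → Set E)
    (hB : ∀ i, IsVecBase K φ (B i)) (hdisj : Pairwise (Function.onFun Disjoint B)) :
    ∃ B' : ι → Set E, (∀ i, IsVecBase K φ (B' i)) ∧ Pairwise (Function.onFun Disjoint B') ∧
      ∀ e, ∃ i, e ∈ B' i := by
  classical
  let State := {p : ℕ × (ι → Set E) // (∀ i, IsVecBase K φ (p.2 i)) ∧
    Pairwise (Function.onFun Disjoint p.2) ∧ ∀ e, h e < p.1 → ∃ i, e ∈ p.2 i}
  have hstep : ∀ s : State, ∃ s' : State, s.1.1 < s'.1.1 ∧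
      (∀ e, h e < s.1.1 → ∀ i, e ∈ s'.1.2 i ↔ e ∈ s.1.2 i) ∧
      ∀ e, h e < s.1.1 → ∀ i, φ e ∈ span K (φ '' (s'.1.2 i ∩ {e | h e < s'.1.1})) := by
    rintro ⟨⟨n, S⟩, hS, hSd, hSc⟩
    have hspan : ∀ {a b : ℕ}, a ≤ b → ∀ T : Set E,
        span K (φ '' (T ∩ {e | h e < a})) ≤ span K (φ '' (T ∩ {e | h e < b})) := fun hab T =>
      span_mono (Set.image_mono (Set.inter_subset_inter_right T fun x hx => lt_of_lt_of_le hx hab))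
    have hbound : ∀ e, ∃ k, ∀ i, φ e ∈ span K (φ '' (S i ∩ {e | h e < k})) := by
      intro e
      have : ∀ i, ∃ k, φ e ∈ span K (φ '' (S i ∩ {e | h e < k})) := by
        intro i
        obtain ⟨l, hl, hle⟩ := (Finsupp.mem_span_image_iff_linearCombination K).1 ((hS i).2 e)
        refine ⟨l.support.sup h + 1, (Finsupp.mem_span_image_iff_linearCombination K).2
          ⟨l, fun x hx => ⟨hl hx, Nat.lt_succ_of_le (Finset.le_sup (f := h) hx)⟩, hle⟩⟩
      choose k hk using this
      obtain ⟨b, hb⟩ := (Set.finite_range k).bddAbove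
      exact ⟨b, fun i => hspan (hb ⟨i, rfl⟩) (S i) (hk i)⟩
    choose k hk using hbound
    obtain ⟨b, hb⟩ := ((finite_setOf_level_lt hc n).image k).bddAbove
    obtain ⟨S', h1, h2, h3, h4, h5⟩ := exists_isVecBase_cover_extension hc htri
      (n := n) (m := max b (n + 1)) (by omega) hS hSd hSc
    refine ⟨⟨⟨max b (n + 1), S'⟩, h1, h2, h5⟩, by simp, h3, fun e he i => h4 i ?_⟩
    exact hspan ((hb ⟨e, he, rfl⟩).trans (le_max_left _ _)) (S i) (hk e i)
  choose next hnext1 hnext2 hnext3 using hstep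
  let s : ℕ → State := fun k => next^[k] ⟨⟨0, B⟩, hB, hdisj, fun e he => absurd he (by simp)⟩
  have hs : ∀ k, s (k + 1) = next (s k) := fun k => Function.iterate_succ_apply' _ _ _
  have hlt : ∀ k, (s k).1.1 < (s (k + 1)).1.1 := fun k => by
    rw [hs]
    exact hnext1 _
  have hmono : StrictMono fun k => (s k).1.1 := strictMono_nat_of_lt_succ hlt
  have hstable : ∀ k l, k ≤ l → ∀ e, h e < (s k).1.1 → ∀ i,
      e ∈ (s l).1.2 i ↔ e ∈ (s k).1.2 i := by
    intro k l hkl e he i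
    induction l, hkl using Nat.le_induction with
    | base => rfl
    | succ l hkl ih =>
      rw [← ih, hs]
      exact hnext2 _ e (he.trans_le (hmono.monotone hkl)) i
  have hlevel : ∀ e, ∃ k, h e < (s k).1.1 := fun e =>
    ⟨h e + 1, (Nat.lt_succ_self _).trans_le (hmono.le_apply (x := h e + 1))⟩
  let B' : ι → Set E := fun i => ⋃ k, (s k).1.2 i ∩ {e | h e < (s k).1.1}
  refine ⟨B', fun i => ⟨?_, fun e => ?_⟩, ?_, fun e => ?_⟩
  · refine linearIndepOn_iUnion_of_directed (Monotone.directed_le ?_) fun k =>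
      ((s k).2.1 i).1.mono Set.inter_subset_left
    intro k l hkl e he
    exact ⟨(hstable k l hkl e he.2 i).2 he.1, lt_of_lt_of_le he.2 (hmono.monotone hkl)⟩
  · obtain ⟨k, hk⟩ := hlevel e
    have := hnext3 (s k) e hk i
    rw [← hs] at this
    exact span_mono (Set.image_mono (Set.subset_iUnion
      (fun k => (s k).1.2 i ∩ {e | h e < (s k).1.1}) (k + 1))) this
  · intro a b hab
    refine Set.disjoint_left.2 fun x hxa hxb => ?_
    obtain ⟨k, hka, hk⟩ := Set.mem_iUnion.1 hxa
    obtain ⟨l, hlb, hl⟩ := Set.mem_iUnion.1 hxb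
    rcases le_total k l with hkl | hkl
    · exact Set.disjoint_left.1 ((s l).2.2.1 hab) ((hstable k l hkl x hk a).2 hka) hlb
    · exact Set.disjoint_left.1 ((s k).2.2.1 hab) hka ((hstable l k hkl x hl b).2 hlb)
  · obtain ⟨k, hk⟩ := hlevel e
    obtain ⟨i, hi⟩ := (s k).2.2.2 e hk
    exact ⟨i, Set.mem_iUnion.2 ⟨k, hi, hk⟩⟩

end VecBase


section Incidence

open Submodule

variable {V Y Z : Type*}

/-- The vector of an edge: the sum of the vectors of its ends. -/
def incidence [AddCommMonoid Y] (w : V → Y) : Sym2 V → Y :=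
  Sym2.lift ⟨fun a b => w a + w b, fun a b => add_comm (w a) (w b)⟩

@[simp] lemma incidence_mk [AddCommMonoid Y] (w : V → Y) (a b : V) :
    incidence w s(a, b) = w a + w b := rfl

lemma map_incidence [AddCommGroup Y] [Module (ZMod 2) Y] [AddCommGroup Z] [Module (ZMod 2) Z]
    (f : Y →ₗ[ZMod 2] Z) (w : V → Y) (e : Sym2 V) :
    f (incidence w e) = incidence (fun a => f (w a)) e := by
  induction e with
  | h a b => simp

open Classical in
/-- The unit vector of `a`, replaced by `0` if `a` is not in `P`. -/
noncomputable def unitVec (P : Set V) (a : V) : V →₀ ZMod 2 :=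
  if a ∈ P then Finsupp.single a 1 else 0

lemma unitVec_of_mem {P : Set V} {a : V} (ha : a ∈ P) : unitVec P a = Finsupp.single a 1 :=
  if_pos ha

lemma unitVec_of_notMem {P : Set V} {a : V} (ha : a ∉ P) : unitVec P a = 0 := if_neg ha

/-- The projection onto the coordinates in `P`. -/
noncomputable def coordProj (P : Set V) : (V →₀ ZMod 2) →ₗ[ZMod 2] (V →₀ ZMod 2) :=
  Finsupp.linearCombination (ZMod 2) (unitVec P)

lemma coordProj_incidence (P : Set V) (e : Sym2 V) :
    coordProj P (incidence (unitVec Set.univ) e) = incidence (unitVec P) e := by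
  rw [map_incidence]
  congr 1
  ext1 a
  simp [coordProj, unitVec_of_mem]

open Classical in
/-- The functional summing up the coordinates in `S`. -/
noncomputable def coordSum (S : Set V) : (V →₀ ZMod 2) →ₗ[ZMod 2] ZMod 2 :=
  Finsupp.linearCombination (ZMod 2) fun a => if a ∈ S then 1 else 0

open Classical in
lemma coordSum_unitVec {S P : Set V} (hS : S ⊆ P) (a : V) :
    coordSum S (unitVec P a) = if a ∈ S then 1 else 0 := by
  by_cases ha : a ∈ P
  · simp [unitVec_of_mem ha, coordSum]
  · have : a ∉ S := fun h => ha (hS h)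
    simp [unitVec_of_notMem ha, this]

lemma coordSum_incidence_eq_zero {S P : Set V} (hS : S ⊆ P) {a b : V} (hab : a ∈ S ↔ b ∈ S) :
    coordSum S (incidence (unitVec P) s(a, b)) = 0 := by
  rw [incidence_mk, map_add, coordSum_unitVec hS, coordSum_unitVec hS]
  by_cases ha : a ∈ S
  · simp only [ha, hab.1 ha, if_true]
    decide
  · simp [ha, mt hab.2 ha]

lemma coordSum_incidence_eq_one {S P : Set V} (hS : S ⊆ P) {a b : V} (ha : a ∈ S) (hb : b ∉ S) :
    coordSum S (incidence (unitVec P) s(a, b)) = 1 := by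
  rw [incidence_mk, map_add, coordSum_unitVec hS, coordSum_unitVec hS]
  simp [ha, hb]

/-- A vector on which a functional vanishing on a family is nonzero is not in its span. -/
lemma notMem_span_image_of_functional {E K : Type*} [Field K] [AddCommGroup Y] [Module K Y]
    {φ : E → Y} {A : Set E} {y : Y} (f : Y →ₗ[K] K) (hA : ∀ e ∈ A, f (φ e) = 0) (hy : f y ≠ 0) :
    y ∉ span K (φ '' A) := fun hmem => hy <| by
  have : span K (φ '' A) ≤ LinearMap.ker f := by
    rw [span_le]
    rintro _ ⟨e, he, rfl⟩
    exact hA e he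
  exact this hmem

lemma add_mem_span_of_reachable {H : SimpleGraph V} {a b : V} (hab : H.Reachable a b) :
    unitVec Set.univ a + unitVec Set.univ b ∈
      span (ZMod 2) (incidence (unitVec Set.univ) '' H.edgeSet) := by
  obtain ⟨p⟩ := hab
  induction p with
  | nil =>
    rw [ZModModule.add_self]
    exact zero_mem _
  | @cons a b c hadj p ih =>
    have h1 : unitVec Set.univ a + unitVec Set.univ b ∈
        span (ZMod 2) (incidence (unitVec Set.univ) '' H.edgeSet) :=
      subset_span ⟨s(a, b), hadj, rfl⟩
    have h2 := add_mem h1 ih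
    rwa [add_assoc, ← add_assoc (unitVec Set.univ b), ZModModule.add_self, zero_add] at h2

lemma isAcyclic_of_linearIndepOn {T : SimpleGraph V}
    (hT : LinearIndepOn (ZMod 2) (incidence (unitVec Set.univ)) T.edgeSet) : T.IsAcyclic := by
  rw [SimpleGraph.isAcyclic_iff_forall_adj_isBridge]
  intro a b hab
  rw [SimpleGraph.isBridge_iff]
  intro hreach
  refine hT.notMem_span (i := s(a, b)) hab ?_
  have := add_mem_span_of_reachable hreach
  rwa [SimpleGraph.edgeSet_deleteEdges] at this

end Incidence

/-- Every tree can be rooted at any of its vertices: there are a parent map and a depth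
function. -/
lemma SimpleGraph.IsTree.exists_parent {V : Type*} {T : SimpleGraph V} (hT : T.IsTree) (o : V) :
    ∃ (p : V → V) (d : V → ℕ), p o = o ∧ (∀ x, x ≠ o → T.Adj x (p x) ∧ d (p x) < d x) ∧
      ∀ a b, T.Adj a b → (a ≠ o ∧ b = p a) ∨ (b ≠ o ∧ a = p b) := by
  classical
  have hpar : ∀ x, ∃ y, (x = o → y = o) ∧ (x ≠ o → T.Adj x y ∧ T.dist y o < T.dist x o) := by
    intro x
    by_cases hx : x = o
    · exact ⟨o, fun _ => rfl, fun h => absurd hx h⟩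
    · obtain ⟨w, hw⟩ := hT.connected.exists_walk_length_eq_dist x o
      cases w with
      | nil => exact absurd rfl hx
      | @cons _ y _ hadj q =>
        refine ⟨y, fun h => absurd h hx, fun _ => ⟨hadj, ?_⟩⟩
        have := T.dist_le q
        rw [SimpleGraph.Walk.length_cons] at hw
        omega
  choose p hpo hp using hpar
  refine ⟨p, fun x => T.dist x o, hpo o rfl, hp, ?_⟩
  let T' : SimpleGraph V := SimpleGraph.fromRel fun a b => a ≠ o ∧ b = p a
  have hle : T' ≤ T := by
    intro a b hab
    rcases (SimpleGraph.fromRel_adj _ a b).1 hab with ⟨-, ⟨h, rfl⟩ | ⟨h, rfl⟩⟩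
    · exact (hp a h).1
    · exact (hp b h).1.symm
  have hreach : ∀ n x, T.dist x o = n → T'.Reachable x o := by
    intro n
    induction n using Nat.strong_induction_on with
    | _ n ih =>
      rintro x rfl
      by_cases hx : x = o
      · rw [hx]
      · have hadj : T'.Adj x (p x) :=
          (SimpleGraph.fromRel_adj _ _ _).2 ⟨(hp x hx).1.ne, Or.inl ⟨hx, rfl⟩⟩
        exact hadj.reachable.trans (ih _ (hp x hx).2 _ rfl)
  have hconn : T'.Connected :=
    (SimpleGraph.connected_iff _).2 ⟨fun a b => (hreach _ a rfl).trans (hreach _ b rfl).symm, ⟨o⟩⟩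
  have heq : T ≤ T' := (SimpleGraph.isTree_iff_minimal_connected.1 hT).2 hconn hle
  intro a b hab
  exact ((SimpleGraph.fromRel_adj _ a b).1 (heq hab)).2

section Blocks

open Submodule

variable {V α : Type*} [LinearOrder α]

/-- The edges of `G` whose higher end, with respect to `r`, has height `u`. -/
abbrev EdgeBlock (G : SimpleGraph V) (r : V → α) (u : α) : Type _ :=
  {e : Sym2 V // e ∈ G.edgeSet ∧ (e.map r).sup = u}

/-- The vertices of height `u` other than the root `o`. -/
abbrev vertexBlock (r : V → α) (o : V) (u : α) : Set V := {x | r x = u ∧ x ≠ o}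

/-- The vectors of the edges of a block, in the coordinates of the vertices of the block:
lower vertices and the root are contracted. -/
noncomputable def blockVec (G : SimpleGraph V) (r : V → α) (o : V) (u : α) :
    EdgeBlock G r u → V →₀ ZMod 2 :=
  fun e => incidence (unitVec (vertexBlock r o u)) e.1

variable {G T : SimpleGraph V} {r : V → α} {o : V}

lemma unitVec_mem_span_block_of_parent (hTG : T ≤ G) {p : V → V} {d : V → ℕ}
    (hp : ∀ x, x ≠ o → T.Adj x (p x) ∧ d (p x) < d x) (hr : ∀ x, r (p x) ≤ r x) (u : α) (x : V) :
    unitVec (vertexBlock r o u) x ∈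
      span (ZMod 2) (blockVec G r o u '' {e | e.1 ∈ T.edgeSet}) := by
  induction hn : d x using Nat.strong_induction_on generalizing x with
  | _ n ih =>
    subst hn
    by_cases hx : x ∈ vertexBlock r o u
    · have hadj := (hp x hx.2).1
      have h1 := ih _ (hp x hx.2).2 (p x) rfl
      have h2 : unitVec (vertexBlock r o u) x + unitVec (vertexBlock r o u) (p x) ∈
          span (ZMod 2) (blockVec G r o u '' {e | e.1 ∈ T.edgeSet}) := by
        refine subset_span ⟨⟨s(x, p x), hTG hadj, ?_⟩, hadj, rfl⟩
        simpa [hx.1] using (hr x).trans_eq hx.1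
      simpa using sub_mem h2 h1
    · rw [unitVec_of_notMem hx]
      exact zero_mem _

/-- If heights do not increase towards the root of a spanning tree, then each block of its
edges is a basis. -/
lemma isVecBase_block_of_parent (hTG : T ≤ G) {p : V → V} {d : V → ℕ} (hpo : p o = o)
    (hp : ∀ x, x ≠ o → T.Adj x (p x) ∧ d (p x) < d x)
    (hT : ∀ a b, T.Adj a b → (a ≠ o ∧ b = p a) ∨ (b ≠ o ∧ a = p b))
    (hr : ∀ x, r (p x) ≤ r x) (u : α) :
    IsVecBase (ZMod 2) (blockVec G r o u) {e | e.1 ∈ T.edgeSet} := by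
  have hiter_o : ∀ k, p^[k] o = o := fun k => Function.iterate_fixed hpo k
  have hiter_r : ∀ k x, r (p^[k] x) ≤ r x := by
    intro k
    induction k with
    | zero => exact fun x => le_rfl
    | succ k ih => exact fun x => (ih (p x)).trans (hr x)
  have hiter_d : ∀ k x, d (p^[k] x) ≤ d x := by
    intro k
    induction k with
    | zero => exact fun x => le_rfl
    | succ k ih =>
      intro x
      refine (ih (p x)).trans ?_
      by_cases hx : x = o
      · rw [hx, hpo]
      · exact (hp x hx).2.le
  have hedge : ∀ e : Sym2 V, e ∈ T.edgeSet → ∃ x, x ≠ o ∧ e = s(x, p x) := by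
    intro e he
    induction e with
    | h a b =>
      rcases hT a b he with ⟨ha, rfl⟩ | ⟨hb, rfl⟩
      · exact ⟨a, ha, rfl⟩
      · exact ⟨b, hb, Sym2.eq_swap⟩
  refine ⟨linearIndepOn_iff_notMem_span.2 ?_, ?_⟩
  · rintro ⟨e, heG, heu⟩ heT
    obtain ⟨x, hxo, rfl⟩ := hedge e heT
    have hxu : r x = u := by
      rw [Sym2.map_mk, Sym2.sup_mk, sup_eq_left.2 (hr x)] at heu
      exact heu
    -- the descendants of `x` in the block
    let S : Set V := {y | y ∈ vertexBlock r o u ∧ ∃ k, p^[k] y = x}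
    have hS : S ⊆ vertexBlock r o u := fun y hy => hy.1
    refine notMem_span_image_of_functional (coordSum S) ?_ ?_
    · rintro ⟨e', he'G, he'u⟩ ⟨he'T, hne⟩
      obtain ⟨y, hyo, rfl⟩ := hedge e' he'T
      have hyx : y ≠ x := by
        rintro rfl
        exact hne rfl
      have hyu : r y = u := by
        rw [Sym2.map_mk, Sym2.sup_mk, sup_eq_left.2 (hr y)] at he'u
        exact he'u
      refine coordSum_incidence_eq_zero hS ⟨?_, ?_⟩
      · rintro ⟨-, k, hk⟩
        cases k with
        | zero => exact absurd hk hyx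
        | succ k =>
          have hk' : p^[k] (p y) = x := hk
          refine ⟨⟨le_antisymm ((hr y).trans_eq hyu) ?_, ?_⟩, k, hk'⟩
          · rw [← hxu, ← hk']
            exact hiter_r k _
          · intro hpy
            rw [hpy, hiter_o] at hk'
            exact hxo hk'.symm
      · rintro ⟨-, k, hk⟩
        exact ⟨⟨hyu, hyo⟩, k + 1, hk⟩
    · have hxS : x ∈ S := ⟨⟨hxu, hxo⟩, 0, rfl⟩
      have hpxS : p x ∉ S := by
        rintro ⟨-, k, hk⟩
        have h1 := hiter_d k (p x)
        rw [hk] at h1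
        exact absurd (hp x hxo).2 (not_lt.2 h1)
      rw [blockVec, coordSum_incidence_eq_one hS hxS hpxS]
      exact one_ne_zero
  · rintro ⟨e, he⟩
    induction e with
    | h a b =>
      exact add_mem (unitVec_mem_span_block_of_parent hTG hp hr u a)
        (unitVec_mem_span_block_of_parent hTG hp hr u b)

/-- A spanning subgraph all of whose blocks are bases spanning the coordinates of the block
is a tree. -/
lemma isTree_of_isVecBase_block [WellFoundedLT α] (hTG : T ≤ G)
    (hT : ∀ u, LinearIndepOn (ZMod 2) (blockVec G r o u) {e | e.1 ∈ T.edgeSet})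
    (hspan : ∀ u x, unitVec (vertexBlock r o u) x ∈
      span (ZMod 2) (blockVec G r o u '' {e | e.1 ∈ T.edgeSet})) : T.IsTree := by
  have hreach : ∀ u x, r x = u → T.Reachable x o := by
    intro u
    induction u using WellFoundedLT.induction with
    | ind u ih =>
      intro x hx
      by_contra hxo
      have hxo' : x ≠ o := by
        rintro rfl
        exact hxo (SimpleGraph.Reachable.refl _)
      let S : Set V := {y | y ∈ vertexBlock r o u ∧ T.Reachable x y}
      have hS : S ⊆ vertexBlock r o u := fun y hy => hy.1
      have hmemS : ∀ y, r y ≤ u → T.Reachable x y → y ∈ S := by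
        intro y hy hxy
        refine ⟨⟨hy.antisymm (not_lt.1 fun hlt => hxo (hxy.trans (ih _ hlt y rfl))), ?_⟩, hxy⟩
        rintro rfl
        exact hxo hxy
      refine notMem_span_image_of_functional (coordSum S) ?_ ?_ (hspan u x)
      · rintro ⟨e, heG, heu⟩ heT
        induction e with
        | h a b =>
          have hab : T.Adj a b := heT
          rw [Sym2.map_mk, Sym2.sup_mk] at heu
          exact coordSum_incidence_eq_zero hS
            ⟨fun ha => hmemS b (heu ▸ le_sup_right) (ha.2.trans hab.reachable),
              fun hb => hmemS a (heu ▸ le_sup_left) (hb.2.trans hab.symm.reachable)⟩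
      · have hxS : x ∈ S := hmemS x hx.le (SimpleGraph.Reachable.refl _)
        rw [coordSum_unitVec hS, if_pos hxS]
        exact one_ne_zero
  refine ⟨(SimpleGraph.connected_iff _).2
      ⟨fun a b => (hreach _ a rfl).trans (hreach _ b rfl).symm, ⟨o⟩⟩, isAcyclic_of_linearIndepOn ?_⟩
  refine linearIndepOn_of_triangular (fun e => (e.map r).sup)
    (fun u => coordProj (vertexBlock r o u)) ?_ ?_
  · intro u e _ heu
    rw [coordProj_incidence]
    induction e with
    | h a b =>
      rw [Sym2.map_mk, Sym2.sup_mk, sup_lt_iff] at heu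
      rw [incidence_mk, unitVec_of_notMem fun h => heu.1.ne h.1,
        unitVec_of_notMem fun h => heu.2.ne h.1, add_zero]
  · intro u
    simp only [coordProj_incidence]
    have h1 : LinearIndependent (ZMod 2)
        fun e : {e : EdgeBlock G r u | e.1 ∈ T.edgeSet} => blockVec G r o u e.1 := hT u
    exact h1.comp (fun e : {e | e ∈ T.edgeSet ∧ (e.map r).sup = u} =>
      ⟨⟨e.1, SimpleGraph.edgeSet_mono hTG e.2.1, e.2.2⟩, e.2.1⟩) fun a b hab =>
        Subtype.ext (congrArg (fun x => x.1.1) hab)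

end Blocks

/-- A countable well-order with a relation under which every element has only finitely many,
and smaller, predecessors can be enumerated compatibly with that relation. -/
lemma exists_injective_nat_of_finite_predecessors {P : Type*} [LinearOrder P] [WellFoundedLT P]
    [Countable P] {R : P → P → Prop} (hlt : ∀ y x, R y x → y < x)
    (hfin : ∀ x, {y | R y x}.Finite) :
    ∃ g : P → ℕ, Function.Injective g ∧ ∀ y x, R y x → g y < g x := by
  classical
  obtain ⟨k, hk⟩ := exists_injective_nat P
  have hD : ∀ x, {y | Relation.ReflTransGen R y x}.Finite := by
    intro x
    induction x using WellFoundedLT.induction with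
    | ind x ih =>
      refine (((hfin x).biUnion fun y hy => ih y (hlt y x hy)).insert x).subset fun z hz => ?_
      rcases Relation.ReflTransGen.cases_tail hz with rfl | ⟨y, hzy, hyx⟩
      · exact Set.mem_insert _ _
      · exact Set.mem_insert_of_mem _ (Set.mem_biUnion hyx hzy)
  have hle : ∀ y x, Relation.ReflTransGen R y x → y ≤ x := by
    intro y x h
    induction h with
    | refl => exact le_rfl
    | tail _ h ih => exact ih.trans (hlt _ _ h).le
  have hmem : ∀ y x, y ∈ (hD x).toFinset ↔ Relation.ReflTransGen R y x := by simp
  refine ⟨fun x => ∑ n ∈ (hD x).toFinset.image k, 2 ^ n, fun x y hxy => ?_, fun y x hyx => ?_⟩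
  · have h := Finset.image_injective hk (Finset.geomSum_injective le_rfl hxy)
    refine le_antisymm (hle _ _ ((hmem _ _).1 ?_)) (hle _ _ ((hmem _ _).1 ?_))
    · rw [← h, hmem]
    · rw [h, hmem]
  · refine Finset.sum_lt_sum_of_subset (i := k x) (Finset.image_subset_image fun z hz => ?_)
      (Finset.mem_image_of_mem k ((hmem _ _).2 .refl)) ?_ (by positivity) (by simp)
    · rw [hmem] at hz ⊢
      exact hz.tail hyx
    · rw [hk.mem_finset_image, hmem]
      exact fun h => (hle _ _ h).not_gt (hlt _ _ hyx)

/-- There is a height function that does not increase along given maps and whose fibres are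
not larger than the set of words in these maps. -/
lemma exists_height {V J : Type u} [LinearOrder V] [WellFoundedLT V] (f : V → J → V) :
    ∃ r : V → V, (∀ x j, r (f x j) ≤ r x) ∧ ∀ u, #{x // r x = u} ≤ #(List J) := by
  have hne : ∀ x, {u | ∃ l : List J, l.foldl f u = x}.Nonempty := fun x => ⟨x, [], rfl⟩
  have hmem := fun x => WellFounded.min_mem wellFounded_lt _ (hne x)
  refine ⟨fun x => wellFounded_lt.min _ (hne x), fun x j => ?_, fun u => ?_⟩
  · obtain ⟨l, hl⟩ := hmem x
    refine not_lt.1 (WellFounded.not_lt_min wellFounded_lt _ ?_)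
    refine ⟨l ++ [j], ?_⟩
    rw [List.foldl_append, hl, List.foldl_cons, List.foldl_nil]
  · have h : ∀ x : {x // wellFounded_lt.min _ (hne x) = u}, ∃ l : List J, l.foldl f u = x := by
      rintro ⟨x, rfl⟩
      exact hmem x
    choose l hl using h
    exact mk_le_of_injective (f := l) fun a b hab => Subtype.ext (by rw [← hl a, ← hl b, hab])

section Decomposition

open Submodule

variable {V ι : Type u} [LinearOrder V] {G : SimpleGraph V}

lemma EdgeBlock.exists_mk {r : V → V} (hr : ∀ w x, G.Adj w x → w < x → r w ≤ r x) {u : V}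
    (e : EdgeBlock G r u) : ∃ w x, w < x ∧ G.Adj w x ∧ e.1 = s(w, x) ∧ r x = u := by
  obtain ⟨e, heG, heu⟩ := e
  induction e with
  | h a b =>
    have hab : G.Adj a b := heG
    rw [Sym2.map_mk, Sym2.sup_mk] at heu
    rcases hab.ne.lt_or_gt with h | h
    · exact ⟨a, b, h, hab, rfl, by rw [← heu, sup_eq_right.2 (hr a b hab h)]⟩
    · exact ⟨b, a, h, hab.symm, Sym2.eq_swap, by rw [← heu, sup_eq_left.2 (hr b a hab.symm h)]⟩

lemma exists_partition_isVecBase_block [WellFoundedLT V] {r : V → V} {o : V} (ho : ∀ x, o ≤ x)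
    (hr : ∀ w x, G.Adj w x → w < x → r w ≤ r x) {u : V} (hu : #{x // r x = u} ≤ max ℵ₀ #ι)
    (code : ∀ x, {w // w < x ∧ G.Adj w x} ↪ ι) (B : ι → Set (EdgeBlock G r u))
    (hB : ∀ i, IsVecBase (ZMod 2) (blockVec G r o u) (B i))
    (hdisj : Pairwise (Function.onFun Disjoint B)) :
    ∃ B' : ι → Set (EdgeBlock G r u),
      (∀ i, IsVecBase (ZMod 2) (blockVec G r o u) (B' i)) ∧
      Pairwise (Function.onFun Disjoint B') ∧ ∀ e, ∃ i, e ∈ B' i := by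
  choose lo hi hlt hadj heq hhi using fun e : EdgeBlock G r u => e.exists_mk hr
  have hmem : ∀ e, hi e ∈ vertexBlock r o u := fun e => ⟨hhi e, ((ho _).trans_lt (hlt e)).ne'⟩
  let c : EdgeBlock G r u → ι := fun e => code (hi e) ⟨lo e, hlt e, hadj e⟩
  have hc : ∀ e e', hi e = hi e' → c e = c e' → e = e' := by
    have hcode : ∀ {x x' : V} (w : {w // w < x ∧ G.Adj w x}) (w' : {w // w < x' ∧ G.Adj w x'}),
        x = x' → code x w = code x' w' → w.1 = w'.1 := by
      rintro x _ w w' rfl h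
      exact congrArg _ ((code x).injective h)
    intro e e' h h'
    have hlo : lo e = lo e' := hcode _ _ h h'
    exact Subtype.ext (by rw [heq, heq, h, hlo])
  have hone : ∀ e, coordSum {hi e} (blockVec G r o u e) = 1 := by
    intro e
    rw [blockVec, heq, Sym2.eq_swap]
    exact coordSum_incidence_eq_one (Set.singleton_subset_iff.2 (hmem e)) rfl (hlt e).ne
  rcases finite_or_infinite ι with hι | hι
  · have : Countable {x // r x = u} := mk_le_aleph0_iff.1 (hu.trans (max_le le_rfl mk_le_aleph0))
    obtain ⟨g, hg, hgR⟩ := exists_injective_nat_of_finite_predecessors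
      (P := {x // r x = u}) (R := fun y x => y.1 < x.1 ∧ G.Adj y.1 x.1) (fun y x h => h.1) (by
        intro x
        have : Finite {w | w < x.1 ∧ G.Adj w x.1} := Finite.of_injective _ (code x).injective
        exact Set.Finite.preimage Subtype.val_injective.injOn
          (Set.toFinite {w | w < x.1 ∧ G.Adj w x.1}))
    refine exists_partition_isVecBase_of_finite (h := fun e => g ⟨hi e, hhi e⟩) (c := c)
      (fun e e' h h' => hc e e' (congrArg Subtype.val (hg h)) h') (fun e => ?_) B hB hdisj
    refine notMem_span_image_of_functional (coordSum {hi e}) (fun e' he' => ?_)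
      ((hone e).trans_ne one_ne_zero)
    have he'lt : g ⟨hi e', hhi e'⟩ < g ⟨hi e, hhi e⟩ := he'
    have hne : hi e' ≠ hi e := fun h => he'lt.ne (congrArg g (Subtype.ext h))
    have hne' : lo e' ≠ hi e := fun h =>
      he'lt.not_gt (hgR ⟨hi e, hhi e⟩ ⟨hi e', hhi e'⟩
        ⟨h.symm.trans_lt (hlt e'), (congrArg (G.Adj · (hi e')) h).mp (hadj e')⟩)
    rw [blockVec, heq]
    exact coordSum_incidence_eq_zero (Set.singleton_subset_iff.2 (hmem e))
      (iff_of_false hne' hne)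
  · refine exists_partition_isVecBase_of_infinite ?_ (fun e he => ?_) B hB hdisj
    · have h1 : #(EdgeBlock G r u) ≤ #({x // r x = u} × ι) :=
        mk_le_of_injective (f := fun e => (⟨hi e, hhi e⟩, c e)) fun e e' h =>
          hc e e' (congrArg (fun q => q.1.1) h) (congrArg Prod.snd h)
      rw [max_eq_right (aleph0_le_mk ι)] at hu
      refine h1.trans ?_
      rw [mk_prod, lift_id, lift_id]
      exact (mul_le_mul_left hu _).trans_eq (mul_eq_self (aleph0_le_mk ι))
    · have := hone e
      rw [he, map_zero] at this
      exact zero_ne_one this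

lemma exists_decomposition [WellFoundedLT V] {o : V} (ho : ∀ x, o ≤ x)
    (code : ∀ x, {w // w < x ∧ G.Adj w x} ↪ ι) {T : ι → SimpleGraph V}
    (hT : ∀ i, IsSpanningTree G (T i))
    (hdisj : Pairwise fun i j => Disjoint (T i).edgeSet (T j).edgeSet) :
    ∃ T' : ι → SimpleGraph V, (∀ i, IsSpanningTree G (T' i)) ∧
      Pairwise (fun i j => Disjoint (T' i).edgeSet (T' j).edgeSet) ∧
      (⋃ i, (T' i).edgeSet) = G.edgeSet := by
  classical
  choose p d hpo hp hpT using fun i => (hT i).2.exists_parent o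
  let f : V → ι ⊕ ι → V := fun x => Sum.elim
    (fun i => if h : ∃ w, code x w = i then h.choose.1 else x) (fun i => p i x)
  obtain ⟨r, hrf, hrcard⟩ := exists_height f
  have hrp : ∀ i x, r (p i x) ≤ r x := fun i x => hrf x (Sum.inr i)
  have hr : ∀ w x, G.Adj w x → w < x → r w ≤ r x := by
    intro w x hadj hlt
    have h : ∃ w', code x w' = code x ⟨w, hlt, hadj⟩ := ⟨_, rfl⟩
    have hw : f x (Sum.inl (code x ⟨w, hlt, hadj⟩)) = w := by
      simp only [f, Sum.elim_inl, dif_pos h]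
      rw [(code x).injective h.choose_spec]
    exact hw ▸ hrf x (Sum.inl (code x ⟨w, hlt, hadj⟩))
  have hcard : ∀ u, #{x // r x = u} ≤ max ℵ₀ #ι := by
    refine fun u => (hrcard u).trans ((mk_list_le_max _).trans ?_)
    rw [mk_sum, lift_id]
    exact max_le (le_max_left _ _) ((add_le_max _ _).trans (by simp [le_total]))
  have hbase : ∀ u i, IsVecBase (ZMod 2) (blockVec G r o u) {e | e.1 ∈ (T i).edgeSet} :=
    fun u i => isVecBase_block_of_parent (hT i).1 (hpo i) (hp i) (hpT i) (hrp i) u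
  choose B hB hBdisj hBcover using fun u => exists_partition_isVecBase_block ho hr (hcard u) code
    (fun i => {e | e.1 ∈ (T i).edgeSet}) (hbase u) fun i j hij =>
      (hdisj hij).preimage Subtype.val
  let T' : ι → SimpleGraph V := fun i => SimpleGraph.fromEdgeSet
    {e | ∃ h : e ∈ G.edgeSet, ⟨e, h, rfl⟩ ∈ B (e.map r).sup i}
  have hT'mem : ∀ i e, e ∈ (T' i).edgeSet ↔
      ∃ h : e ∈ G.edgeSet, ⟨e, h, rfl⟩ ∈ B (e.map r).sup i := by
    intro i e
    rw [SimpleGraph.edgeSet_fromEdgeSet]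
    exact ⟨fun h => h.1, fun h => ⟨h, G.not_isDiag_of_mem_edgeSet h.1⟩⟩
  have hT'B : ∀ i u, {e : EdgeBlock G r u | e.1 ∈ (T' i).edgeSet} = B u i := by
    rintro i u
    ext ⟨e, heG, rfl⟩
    exact (hT'mem i e).trans ⟨fun h => h.2, fun h => ⟨heG, h⟩⟩
  have hT'G : ∀ i, T' i ≤ G := fun i =>
    SimpleGraph.edgeSet_subset_edgeSet.1 fun e he => ((hT'mem i e).1 he).1
  refine ⟨T', fun i => ⟨hT'G i, ?_⟩, fun i j hij => ?_, ?_⟩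
  · refine isTree_of_isVecBase_block (r := r) (o := o) (hT'G i) (fun u => ?_) (fun u x => ?_)
    · rw [hT'B]
      exact (hB u i).1
    · rw [hT'B]
      refine span_le.2 ?_ (unitVec_mem_span_block_of_parent (hT i).1 (hp i) (hrp i) u x)
      rintro _ ⟨e, -, rfl⟩
      exact (hB u i).2 e
  · exact Set.disjoint_left.2 fun e hi hj => Set.disjoint_left.1 (hBdisj _ hij)
      ((hT'mem i e).1 hi).2 ((hT'mem j e).1 hj).2
  · refine (Set.iUnion_subset fun i => SimpleGraph.edgeSet_mono (hT'G i)).antisymm fun e he => ?_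
    obtain ⟨i, hi⟩ := hBcover (e.map r).sup ⟨e, he, rfl⟩
    exact Set.mem_iUnion.2 ⟨i, (hT'mem i e).2 ⟨he, hi⟩⟩

end Decomposition

/-- If there is a well-ordering of the vertex set of `G` in which every vertex has at
most λ many edges to earlier vertices, and `G` admits a λ-packing, then `G` admits a
λ-decomposition (λ finite or infinite). -/
theorem decomposition_of_packing_and_wellOrder {V : Type u} (G : SimpleGraph V)
    (lam : Cardinal.{u})
    (h : ∃ r : V → V → Prop, IsWellOrder V r ∧
      ∀ v, #{w : V // r w v ∧ G.Adj w v} ≤ lam)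
    (hpack : HasPacking G lam) :
    HasDecomposition G lam := by
  obtain ⟨r, hr, hback⟩ := h
  obtain ⟨ι, T, rfl, hT, hdisj⟩ := hpack
  classical
  let _ : LinearOrder V := linearOrderOfSTO r
  have : WellFoundedLT V := ⟨hr.wf⟩
  have code : ∀ x : V, Nonempty ({w // w < x ∧ G.Adj w x} ↪ ι) := fun x =>
    (le_def _ _).1 (hback x)
  rcases isEmpty_or_nonempty ι with hι | hι
  · refine ⟨ι, T, rfl, hT, hdisj, ?_⟩
    rw [Set.iUnion_of_empty, eq_comm, Set.eq_empty_iff_forall_notMem]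
    intro e he
    induction e with
    | h a b =>
      have hab : G.Adj a b := he
      rcases hab.ne.lt_or_gt with h | h
      · exact hι.elim ((code b).some ⟨a, h, hab⟩)
      · exact hι.elim ((code a).some ⟨b, h, hab.symm⟩)
  · have hV : (Set.univ : Set V).Nonempty :=
      Set.nonempty_iff_univ_nonempty.1 (hT hι.some).2.connected.nonempty
    obtain ⟨T', hT', hdisj', hunion⟩ := exists_decomposition
      (o := wellFounded_lt.min Set.univ hV)
      (fun x => not_lt.1 (WellFounded.not_lt_min wellFounded_lt _ (Set.mem_univ x)))
      (fun x => (code x).some) hT hdisj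
    exact ⟨ι, T', rfl, hT', hdisj', hunion⟩
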